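/- Let G* be a colored 𝔯-partite graph on Ω, let h ≥ 1 and M ≥ 1 be integers, and let S ∈ S_{h,G*} be such that d_{G*}(S⟨v⟩) > 0 for every v ∈ 𝕍₁(S) and 1/M ≤ ∏_{v∈𝕍₁(S)} d_{G*}(S⟨v⟩). Let η be defined for G* with sample size Mh as in the context. Then for every nonempty D ⊆ 𝕍₂(S): ( E_{φ∈Φ(h)}[ ∏_{e∈D} ( 𝟙[G*(φ(e)) = S(e)] − d_{G*}(S⟨e⟩) ) | G*(φ(v)) = S(v) for all v ∈ 𝕍₁(S) ] )² ≤ 2 · min_{e₀∈D} η(S⟨e₀⟩), where φ ∈ Φ(h) is random and 𝟙[·] denotes the Iverson bracket. -/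

import Mathlib

open Finset
open scoped BigOperators Classical

/-! ## Framework: colored partite graphs, complexes, partitionwise maps,
regularization, relative densities and regularity (Ishigami's setting). -/

/-- Partitionwise maps `Φ(h)`: `h` sample vertices in each of the `r` parts. -/
abbrev PMap {r : ℕ} (Ω : Fin r → Type) (h : ℕ) : Type := ∀ i : Fin r, Fin h → Ω i

/-- The product weight of a partitionwise map (each sample independent). -/
noncomputable def pmapWeight {r : ℕ} (Ω : Fin r → Type) [∀ i, Fintype (Ω i)]
    (w : ∀ i, Ω i → ℝ) {h : ℕ} (φ : PMap Ω h) : ℝ :=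
  ∏ i : Fin r, ∏ a : Fin h, w i (φ i a)

/-- Expectation over a random partitionwise map in `Φ(h)`. -/
noncomputable def EPhi {r : ℕ} (Ω : Fin r → Type) [∀ i, Fintype (Ω i)]
    (w : ∀ i, Ω i → ℝ) (h : ℕ) (f : PMap Ω h → ℝ) : ℝ :=
  ∑ φ : PMap Ω h, pmapWeight Ω w φ * f φ

/-- Conditional expectation over a random partitionwise map in `Φ(h)`. -/
noncomputable def EPhiCond {r : ℕ} (Ω : Fin r → Type) [∀ i, Fintype (Ω i)]
    (w : ∀ i, Ω i → ℝ) (h : ℕ) (A : PMap Ω h → Prop) (f : PMap Ω h → ℝ) : ℝ :=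
  (∑ φ : PMap Ω h, if A φ then pmapWeight Ω w φ * f φ else 0) /
  (∑ φ : PMap Ω h, if A φ then pmapWeight Ω w φ else 0)

/-- A colored `𝔯`-partite graph on vertex sets `Ω i`: color sets `C1 i` (for vertices,
i.e. index-`{i}` edges) and `C2 i j` (for index-`{i,j}` edges), together with coloring
maps, symmetric in the two endpoints. -/
structure CGraph {r : ℕ} (Ω : Fin r → Type) (K₁ K₂ : Type) where
  C1 : Fin r → Finset K₁
  C2 : Fin r → Fin r → Finset K₂
  vCol : ∀ i, Ω i → K₁
  eCol : ∀ i j, Ω i → Ω j → K₂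
  eSymm : ∀ i j x y, eCol i j x y = eCol j i y x
  c2Symm : ∀ i j, C2 i j = C2 j i
  vMem : ∀ i x, vCol i x ∈ C1 i
  eMem : ∀ i j x y, eCol i j x y ∈ C2 i j

/-- `G` is `(b₁,b₂)`-colored: each color set `C_I` has at most `b_{|I|}` elements. -/
def CGraph.Bounded {r : ℕ} {Ω : Fin r → Type} {K₁ K₂ : Type}
    (G : CGraph Ω K₁ K₂) (b₁ b₂ : ℕ) : Prop :=
  (∀ i, (G.C1 i).card ≤ b₁) ∧ ∀ i j, i ≠ j → (G.C2 i j).card ≤ b₂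

/-- Relative density `d_G(c)` of a vertex (index-`{i}`) total color `c`:
the probability that a random vertex of `Ω i` has color `c`. -/
noncomputable def dV {r : ℕ} (Ω : Fin r → Type) [∀ i, Fintype (Ω i)]
    (w : ∀ i, Ω i → ℝ) {K₁ K₂ : Type} (G : CGraph Ω K₁ K₂) (i : Fin r) (c : K₁) : ℝ :=
  ∑ x : Ω i, if G.vCol i x = c then w i x else 0

/-- Relative density `d_G(c₂; ci, cj)` of an index-`{i,j}` total color:
the conditional probability that a random edge has color `c₂` given that its
endpoints have colors `ci`, `cj`. -/
noncomputable def dE {r : ℕ} (Ω : Fin r → Type) [∀ i, Fintype (Ω i)]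
    (w : ∀ i, Ω i → ℝ) {K₁ K₂ : Type} (G : CGraph Ω K₁ K₂) (i j : Fin r)
    (c₂ : K₂) (ci cj : K₁) : ℝ :=
  (∑ x : Ω i, ∑ y : Ω j,
      if G.eCol i j x y = c₂ ∧ G.vCol i x = ci ∧ G.vCol j y = cj then w i x * w j y else 0) /
  (∑ x : Ω i, ∑ y : Ω j, if G.vCol i x = ci ∧ G.vCol j y = cj then w i x * w j y else 0)

/-- A (simplicial) complex with `h` vertices in each of the `r` parts: a colored
partite graph where `none` is the (unique) invisible color of each index, and any
edge containing an invisible vertex is invisible. -/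
structure SComplex (r h : ℕ) (K₁ K₂ : Type) where
  vCol : Fin r → Fin h → Option K₁
  eCol : Fin r → Fin r → Fin h → Fin h → Option K₂
  eSymm : ∀ i j a b, eCol i j a b = eCol j i b a
  loopless : ∀ i a b, eCol i i a b = none
  down : ∀ i j a b, vCol i a = none → eCol i j a b = none

/-- `S ∈ S_{h,G}` : the visible colors of the complex `S` are (identified with)
colors of `G`. -/
def SComplex.MemS {r h : ℕ} {Ω : Fin r → Type} {K₁ K₂ : Type}
    (S : SComplex r h K₁ K₂) (G : CGraph Ω K₁ K₂) : Prop :=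
  (∀ i a c, S.vCol i a = some c → c ∈ G.C1 i) ∧
  (∀ i j a b c, S.eCol i j a b = some c → c ∈ G.C2 i j)

/-- `𝕍₁(S)`: the visible vertices of `S`. -/
noncomputable def V1 {r h : ℕ} {K₁ K₂ : Type} (S : SComplex r h K₁ K₂) :
    Finset (Fin r × Fin h) :=
  univ.filter fun p => S.vCol p.1 p.2 ≠ none

/-- `𝕍₂(S)`: the visible (size-2) edges of `S`, listed once each (`i < j`). -/
noncomputable def V2 {r h : ℕ} {K₁ K₂ : Type} (S : SComplex r h K₁ K₂) :
    Finset (Fin r × Fin r × Fin h × Fin h) :=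
  univ.filter fun q => q.1 < q.2.1 ∧ S.eCol q.1 q.2.1 q.2.2.1 q.2.2.2 ≠ none

/-- `d_G(S⟨v⟩)` for a vertex `v` of `S` (junk value `1` on invisible vertices). -/
noncomputable def dVS {r h : ℕ} (Ω : Fin r → Type) [∀ i, Fintype (Ω i)]
    (w : ∀ i, Ω i → ℝ) {K₁ K₂ : Type} (G : CGraph Ω K₁ K₂)
    (S : SComplex r h K₁ K₂) (p : Fin r × Fin h) : ℝ :=
  match S.vCol p.1 p.2 with
  | some c => dV Ω w G p.1 c
  | none => 1

/-- `d_G(S⟨e⟩)` for a size-2 edge `e` of `S` (junk value `1` on invisible edges). -/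
noncomputable def dES {r h : ℕ} (Ω : Fin r → Type) [∀ i, Fintype (Ω i)]
    (w : ∀ i, Ω i → ℝ) {K₁ K₂ : Type} (G : CGraph Ω K₁ K₂)
    (S : SComplex r h K₁ K₂) (q : Fin r × Fin r × Fin h × Fin h) : ℝ :=
  match S.eCol q.1 q.2.1 q.2.2.1 q.2.2.2, S.vCol q.1 q.2.2.1, S.vCol q.2.1 q.2.2.2 with
  | some c₂, some ci, some cj => dE Ω w G q.1 q.2.1 c₂ ci cj
  | _, _, _ => 1

/-- The event `G(φ(v)) = S(v)` for all visible vertices `v` of `S`. -/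
def vEvent {r h : ℕ} {Ω : Fin r → Type} {K₁ K₂ : Type} (G : CGraph Ω K₁ K₂)
    (S : SComplex r h K₁ K₂) (φ : PMap Ω h) : Prop :=
  ∀ p ∈ V1 S, some (G.vCol p.1 (φ p.1 p.2)) = S.vCol p.1 p.2

/-- The event `G(φ(e)) = S(e)` for all visible size-2 edges `e` of `S`. -/
def eEvent {r h : ℕ} {Ω : Fin r → Type} {K₁ K₂ : Type} (G : CGraph Ω K₁ K₂)
    (S : SComplex r h K₁ K₂) (φ : PMap Ω h) : Prop :=
  ∀ q ∈ V2 S, some (G.eCol q.1 q.2.1 (φ q.1 q.2.2.1) (φ q.2.1 q.2.2.2)) =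
    S.eCol q.1 q.2.1 q.2.2.1 q.2.2.2

/-- `P_{φ∈Φ(h)}[G(φ(e)) = S(e) for all e ∈ 𝕍(S)]`. -/
noncomputable def countProb {r h : ℕ} (Ω : Fin r → Type) [∀ i, Fintype (Ω i)]
    (w : ∀ i, Ω i → ℝ) {K₁ K₂ : Type} (G : CGraph Ω K₁ K₂)
    (S : SComplex r h K₁ K₂) : ℝ :=
  EPhi Ω w h fun φ => if vEvent G S φ ∧ eEvent G S φ then 1 else 0

/-- Value of an error function `δ` (defined on index-2 total colors) at `S⟨e⟩`. -/
noncomputable def deltaS {r h : ℕ} {K₁ K₂ : Type} (δ : Fin r → Fin r → K₂ → K₁ → K₁ → ℝ)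
    (S : SComplex r h K₁ K₂) (q : Fin r × Fin r × Fin h × Fin h) : ℝ :=
  match S.eCol q.1 q.2.1 q.2.2.1 q.2.2.2, S.vCol q.1 q.2.2.1, S.vCol q.2.1 q.2.2.2 with
  | some c₂, some ci, some cj => δ q.1 q.2.1 c₂ ci cj
  | _, _, _ => 0

/-- The counting equation (\ref{lj19}) for one complex `S`:
`P[G(φ(e)) = S(e) ∀ e ∈ 𝕍(S)] = ∏_{v∈𝕍₁(S)} d_G(S⟨v⟩) · ∏_{e∈𝕍₂(S)} (d_G(S⟨e⟩) ±̇ δ(S⟨e⟩))`,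
where `a ±̇ b` denotes a suitable number `c` with `max 0 (a-b) ≤ c ≤ min 1 (a+b)`. -/
def CountEqAt {r h : ℕ} (Ω : Fin r → Type) [∀ i, Fintype (Ω i)]
    (w : ∀ i, Ω i → ℝ) {K₁ K₂ : Type} (G : CGraph Ω K₁ K₂)
    (δ : Fin r → Fin r → K₂ → K₁ → K₁ → ℝ) (S : SComplex r h K₁ K₂) : Prop :=
  ∃ c : Fin r × Fin r × Fin h × Fin h → ℝ,
    (∀ q ∈ V2 S, max 0 (dES Ω w G S q - deltaS δ S q) ≤ c q ∧
        c q ≤ min 1 (dES Ω w G S q + deltaS δ S q)) ∧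
    countProb Ω w G S = (∏ p ∈ V1 S, dVS Ω w G S p) * ∏ q ∈ V2 S, c q

/-- `δ` is an `h`-error function of `G`: the counting equation holds for every
`S ∈ S_{h,G}`. -/
def IsErrorFun {r : ℕ} (Ω : Fin r → Type) [∀ i, Fintype (Ω i)]
    (w : ∀ i, Ω i → ℝ) {K₁ K₂ : Type} (G : CGraph Ω K₁ K₂) (h : ℕ)
    (δ : Fin r → Fin r → K₂ → K₁ → K₁ → ℝ) : Prop :=
  ∀ S : SComplex r h K₁ K₂, S.MemS G → CountEqAt Ω w G δ S

/-- `E_{e∈Ω_I}[δ(G⟨e⟩)]` for `I = {i,j}`. -/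
noncomputable def EdgeDeltaAvg {r : ℕ} (Ω : Fin r → Type) [∀ i, Fintype (Ω i)]
    (w : ∀ i, Ω i → ℝ) {K₁ K₂ : Type} (G : CGraph Ω K₁ K₂)
    (δ : Fin r → Fin r → K₂ → K₁ → K₁ → ℝ) (i j : Fin r) : ℝ :=
  ∑ x : Ω i, ∑ y : Ω j,
    w i x * w j y * δ i j (G.eCol i j x y) (G.vCol i x) (G.vCol j y)

/-- `G` is `(ε,h)`-regular. -/
def IsRegularG {r : ℕ} (Ω : Fin r → Type) [∀ i, Fintype (Ω i)]
    (w : ∀ i, Ω i → ℝ) {K₁ K₂ : Type} (G : CGraph Ω K₁ K₂) (h : ℕ) (ε : ℝ) : Prop :=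
  ∃ δ : Fin r → Fin r → K₂ → K₁ → K₁ → ℝ,
    (∀ i j c₂ ci cj, 0 ≤ δ i j c₂ ci cj) ∧
    IsErrorFun Ω w G h δ ∧
    ∀ i j : Fin r, i ≠ j → EdgeDeltaAvg Ω w G δ i j ≤ ε / (G.C2 i j).card

/-- `reg_h(G)`: the minimum `ε` such that `G` is `(ε,h)`-regular. -/
noncomputable def reg {r : ℕ} (Ω : Fin r → Type) [∀ i, Fintype (Ω i)]
    (w : ∀ i, Ω i → ℝ) {K₁ K₂ : Type} (G : CGraph Ω K₁ K₂) (h : ℕ) : ℝ :=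
  sInf {ε : ℝ | IsRegularG Ω w G h ε}

/-- The regularization `G/φ` of `G` by a partitionwise map `φ ∈ Φ(m)`: each vertex
`v ∈ Ω i` is recolored by its original color together with the colors of all edges
joining `v` to the sample points of `φ` in the other parts. Size-2 edges keep
their colors. -/
noncomputable def regz {r : ℕ} (Ω : Fin r → Type) [∀ i, Fintype (Ω i)]
    {K₁ K₂ : Type} [Fintype K₁] [Fintype K₂] (G : CGraph Ω K₁ K₂) {m : ℕ}
    (φ : PMap Ω m) : CGraph Ω (K₁ × (Fin r → Fin m → Option K₂)) K₂ where
  C1 i := univ.filter fun p : K₁ × (Fin r → Fin m → Option K₂) =>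
    p.1 ∈ G.C1 i ∧ ∀ j b, if j = i then p.2 j b = none
      else ∃ c ∈ G.C2 i j, p.2 j b = some c
  C2 := G.C2
  vCol i x := (G.vCol i x, fun j b => if j = i then none else some (G.eCol i j x (φ j b)))
  eCol := G.eCol
  eSymm := G.eSymm
  c2Symm := G.c2Symm
  vMem := by
    intro i x
    simp only [mem_filter, mem_univ, true_and]
    refine ⟨G.vMem i x, fun j b => ?_⟩
    by_cases hj : j = i
    · simp [hj]
    · simp only [hj, if_neg hj]
      exact ⟨G.eCol i j x (φ j b), G.eMem i j x (φ j b), rfl⟩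
  eMem := G.eMem

/-- Conditional expectation of `f` over a random pair `e = (x,y) ∈ Ω_{i} × Ω_{j}`
given the event `A`. -/
noncomputable def condEE {r : ℕ} (Ω : Fin r → Type) [∀ i, Fintype (Ω i)]
    (w : ∀ i, Ω i → ℝ) (i j : Fin r) (A : Ω i → Ω j → Prop) (f : Ω i → Ω j → ℝ) : ℝ :=
  (∑ x : Ω i, ∑ y : Ω j, if A x y then w i x * w j y * f x y else 0) /
  (∑ x : Ω i, ∑ y : Ω j, if A x y then w i x * w j y else 0)

/-- `e ≈_{∂(G/ψ)} e'` : the two pairs have the same frame color in the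
regularization `G/ψ`. -/
def frameRel {r : ℕ} (Ω : Fin r → Type) [∀ i, Fintype (Ω i)]
    {K₁ K₂ : Type} [Fintype K₁] [Fintype K₂] (G : CGraph Ω K₁ K₂) {m : ℕ}
    (ψ : PMap Ω m) (i j : Fin r) (x : Ω i) (y : Ω j) (x' : Ω i) (y' : Ω j) : Prop :=
  (regz Ω G ψ).vCol i x = (regz Ω G ψ).vCol i x' ∧
  (regz Ω G ψ).vCol j y = (regz Ω G ψ).vCol j y'

/-- `η(c₂; ci, cj)` (eq. (\ref{061220})) computed in `G`, with `N` random sample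
vertices in each part (`N = M·h` in the paper). -/
noncomputable def eta {r : ℕ} (Ω : Fin r → Type) [∀ i, Fintype (Ω i)]
    (w : ∀ i, Ω i → ℝ) {K₁ K₂ : Type} [Fintype K₁] [Fintype K₂]
    (G : CGraph Ω K₁ K₂) (N : ℕ) (i j : Fin r) (c₂ : K₂) (ci cj : K₁) : ℝ :=
  EPhi Ω w N fun ψ =>
    condEE Ω w i j (fun x' y' => G.vCol i x' = ci ∧ G.vCol j y' = cj) fun x' y' =>
      (condEE Ω w i j (fun x y => frameRel Ω G ψ i j x y x' y')
          (fun x y => if G.eCol i j x y = c₂ then 1 else 0) -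
        dE Ω w G i j c₂ ci cj) ^ 2

/-- `η(S⟨e⟩)` for a size-2 edge of a complex `S` (junk value `0` if invisible). -/
noncomputable def etaS {r h : ℕ} (Ω : Fin r → Type) [∀ i, Fintype (Ω i)]
    (w : ∀ i, Ω i → ℝ) {K₁ K₂ : Type} [Fintype K₁] [Fintype K₂]
    (G : CGraph Ω K₁ K₂) (N : ℕ) (S : SComplex r h K₁ K₂)
    (q : Fin r × Fin r × Fin h × Fin h) : ℝ :=
  match S.eCol q.1 q.2.1 q.2.2.1 q.2.2.2, S.vCol q.1 q.2.2.1, S.vCol q.2.1 q.2.2.2 with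
  | some c₂, some ci, some cj => eta Ω w G N q.1 q.2.1 c₂ ci cj
  | _, _, _ => 0

/-- `ε₁ := (ε/(6 b₂ binom(r,2)))²`. -/
noncomputable def eps1 (r b₂ : ℕ) (ε : ℝ) : ℝ := (ε / (6 * b₂ * r.choose 2)) ^ 2

/-- `C := √2 · binom(r,2) h² · (b₂/√ε₁)^{binom(r,2)h² − 1}`. -/
noncomputable def Cconst (r h b₂ : ℕ) (ε : ℝ) : ℝ :=
  Real.sqrt 2 * r.choose 2 * h ^ 2 *
    ((b₂ : ℝ) / Real.sqrt (eps1 r b₂ ε)) ^ (r.choose 2 * h ^ 2 - 1)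

/-- `M(m) := (b₁ b₂^{(r−1)m} / √ε₁)^{rh}` (as a sample count). -/
noncomputable def Mconst (r h b₁ b₂ : ℕ) (ε : ℝ) (m : ℕ) : ℕ :=
  ⌈(((b₁ : ℝ) * (b₂ : ℝ) ^ ((r - 1) * m)) / Real.sqrt (eps1 r b₂ ε)) ^ (r * h)⌉₊

/-- A vertex total color `c` of index `{i}` is bad. -/
def BadV {r : ℕ} (Ω : Fin r → Type) [∀ i, Fintype (Ω i)]
    (w : ∀ i, Ω i → ℝ) {K₁ K₂ : Type} (G : CGraph Ω K₁ K₂) (ε₁ : ℝ)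
    (i : Fin r) (c : K₁) : Prop :=
  dV Ω w G i c ≤ Real.sqrt ε₁ / (G.C1 i).card

/-- An index-`{i,j}` total color `(c₂; ci, cj)` is bad: some nonempty `I* ⊆ {i,j}`
has relative density at most `√ε₁/|C_{I*}|`. -/
def BadE {r : ℕ} (Ω : Fin r → Type) [∀ i, Fintype (Ω i)]
    (w : ∀ i, Ω i → ℝ) {K₁ K₂ : Type} (G : CGraph Ω K₁ K₂) (ε₁ : ℝ)
    (i j : Fin r) (c₂ : K₂) (ci cj : K₁) : Prop :=
  BadV Ω w G ε₁ i ci ∨ BadV Ω w G ε₁ j cj ∨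
    dE Ω w G i j c₂ ci cj ≤ Real.sqrt ε₁ / (G.C2 i j).card

/-- The error function `δ` of the paper: `1` on bad total colors, `C·√η` otherwise. -/
noncomputable def deltaDef {r : ℕ} (Ω : Fin r → Type) [∀ i, Fintype (Ω i)]
    (w : ∀ i, Ω i → ℝ) {K₁ K₂ : Type} [Fintype K₁] [Fintype K₂]
    (G : CGraph Ω K₁ K₂) (ε₁ Cc : ℝ) (N : ℕ)
    (i j : Fin r) (c₂ : K₂) (ci cj : K₁) : ℝ :=
  if BadE Ω w G ε₁ i j c₂ ci cj then 1 else Cc * Real.sqrt (eta Ω w G N i j c₂ ci cj)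

/-- `∏_{e∈D}(𝟙[G(φ(e)) = S(e)] − d_G(S⟨e⟩))`, single factor. -/
noncomputable def indMinusD {r h : ℕ} (Ω : Fin r → Type) [∀ i, Fintype (Ω i)]
    (w : ∀ i, Ω i → ℝ) {K₁ K₂ : Type} (G : CGraph Ω K₁ K₂)
    (S : SComplex r h K₁ K₂) (φ : PMap Ω h) (q : Fin r × Fin r × Fin h × Fin h) : ℝ :=
  (if some (G.eCol q.1 q.2.1 (φ q.1 q.2.2.1) (φ q.2.1 q.2.2.2)) =
      S.eCol q.1 q.2.1 q.2.2.1 q.2.2.2 then 1 else 0) - dES Ω w G S q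

theorem aux_first {X : Type*} [Fintype X] (W : X → ℝ) (hW : ∀ x, 0 ≤ W x) (hW1 : ∑ x, W x = 1)
    (V : X → Prop) (g : X → ℝ) (M : ℕ) (T : (Fin M → X) → ℝ) (hT0 : ∀ ψ, 0 ≤ T ψ)
    (hT : ∀ ψ m, V (ψ m) → g (ψ m) ≤ T ψ) :
    (1 - (1 - ∑ x, if V x then W x else 0) ^ M) * (∑ x, if V x then W x * g x else 0) ≤
      (∑ x, if V x then W x else 0) * ∑ ψ : Fin M → X, (∏ m, W (ψ m)) * T ψ := by
  have hp0 : 0 ≤ ∑ x, (if V x then W x else 0) :=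
    Finset.sum_nonneg fun x _ => by split_ifs; exacts [hW x, le_rfl]
  have hq : 1 - (∑ x, if V x then W x else 0) = ∑ x, if V x then 0 else W x := by
    rw [← hW1, ← Finset.sum_sub_distrib]
    refine Finset.sum_congr rfl fun x _ => ?_
    split_ifs <;> ring
  set p := ∑ x, (if V x then W x else 0) with hp
  set E := ∑ x, (if V x then W x * g x else 0) with hE
  induction M with
  | zero =>
    simp only [pow_zero, sub_self, zero_mul]
    exact mul_nonneg hp0 (Finset.sum_nonneg fun ψ _ =>
      mul_nonneg (Finset.prod_nonneg fun _ _ => hW _) (hT0 ψ))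
  | succ M ih =>
    have e : ∑ ψ : Fin (M+1) → X, (∏ m, W (ψ m)) * T ψ =
        ∑ x, W x * ∑ ψ : Fin M → X, (∏ m, W (ψ m)) * T (Fin.cons x ψ) := by
      rw [← (Fin.consEquiv (fun _ : Fin (M+1) => X)).sum_comp, Fintype.sum_prod_type]
      refine Finset.sum_congr rfl fun x _ => ?_
      rw [Finset.mul_sum]
      refine Finset.sum_congr rfl fun ψ _ => ?_
      simp [Fin.consEquiv, Fin.prod_univ_succ, mul_assoc]
    have tot : ∑ ψ : Fin M → X, (∏ m, W (ψ m)) = 1 := by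
      have := (Finset.prod_univ_sum (fun _ : Fin M => (Finset.univ : Finset X)) (fun _ x => W x))
      simp only [hW1, Fintype.piFinset_univ, Finset.prod_const_one] at this
      exact this.symm
    have key : ∀ x, (if V x then p * (W x * g x) else 0) +
        (if V x then 0 else W x) * ((1 - (1 - p) ^ M) * E) ≤
        p * (W x * ∑ ψ : Fin M → X, (∏ m, W (ψ m)) * T (Fin.cons x ψ)) := by
      intro x
      by_cases hx : V x
      · simp only [hx, if_true, zero_mul, add_zero]
        refine mul_le_mul_of_nonneg_left (mul_le_mul_of_nonneg_left ?_ (hW x)) hp0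
        calc g x = ∑ ψ : Fin M → X, (∏ m, W (ψ m)) * g x := by
              rw [← Finset.sum_mul, tot, one_mul]
          _ ≤ _ := Finset.sum_le_sum fun ψ _ => mul_le_mul_of_nonneg_left
              (by simpa using hT (Fin.cons x ψ) 0 (by simpa using hx))
              (Finset.prod_nonneg fun _ _ => hW _)
      · simp only [hx, if_false, zero_add]
        have := ih (fun ψ => T (Fin.cons x ψ)) (fun ψ => hT0 _)
          (fun ψ m hm => by simpa using hT (Fin.cons x ψ) m.succ (by simpa using hm))
        nlinarith [mul_le_mul_of_nonneg_left this (hW x)]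
    rw [e]
    refine le_trans ?_ (le_of_eq (Finset.mul_sum _ _ _).symm)
    refine le_trans (le_of_eq ?_) (Finset.sum_le_sum fun x _ => key x)
    rw [Finset.sum_add_distrib, ← Finset.sum_mul, ← hq]
    have : ∑ x, (if V x then p * (W x * g x) else 0) = p * E := by
      rw [hE, Finset.mul_sum]
      exact Finset.sum_congr rfl fun x _ => by split_ifs <;> simp
    rw [this]
    ring

theorem aux_tower {Z : Type*} [Fintype Z] (μ : Z → ℝ) (hμ : ∀ z, 0 ≤ μ z)
    (R : Z → Z → Prop) (hrefl : ∀ z, R z z) (hsymm : ∀ z z', R z z' → R z' z)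
    (htrans : ∀ a b c, R a b → R b c → R a c)
    (f K : Z → ℝ) (hK : ∀ z z', R z z' → K z = K z') :
    ∑ z, μ z * K z * ((∑ z', if R z' z then μ z' * f z' else 0) / (∑ z', if R z' z then μ z' else 0))
      = ∑ z, μ z * K z * f z := by
  have hm : ∀ a b, R a b → (∑ z', if R z' a then μ z' else 0) = (∑ z', if R z' b then μ z' else 0) := by
    intro a b hab
    refine Finset.sum_congr rfl fun z _ => ?_
    have : R z a ↔ R z b := ⟨fun h => htrans _ _ _ h hab, fun h => htrans _ _ _ h (hsymm _ _ hab)⟩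
    simp [this]
  calc _ = ∑ z, ∑ z', (if R z' z then μ z * K z * (μ z' * f z') / (∑ z', if R z' z then μ z' else 0) else 0) := by
        refine Finset.sum_congr rfl fun z _ => ?_
        rw [Finset.sum_div, Finset.mul_sum]
        refine Finset.sum_congr rfl fun z' _ => ?_
        split_ifs <;> ring
    _ = ∑ z', ∑ z, (if R z z' then μ z else 0) * (μ z' * K z' * f z' / (∑ y, if R y z' then μ y else 0)) := by
        rw [Finset.sum_comm]
        refine Finset.sum_congr rfl fun z' _ => Finset.sum_congr rfl fun z _ => ?_
        by_cases hR : R z' z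
        · have h2 := hsymm _ _ hR
          rw [if_pos hR, if_pos h2, hK _ _ h2, hm _ _ h2]; ring
        · rw [if_neg hR, if_neg (fun h => hR (hsymm _ _ h)), zero_mul]
    _ = _ := by
        refine Finset.sum_congr rfl fun z _ => ?_
        rw [← Finset.sum_mul]
        by_cases h0 : (∑ y, if R y z then μ y else 0) = 0
        · have : μ z = 0 := by
            have := (Finset.sum_eq_zero_iff_of_nonneg (fun y _ => by
              split_ifs; exacts [hμ y, le_rfl])).1 h0 z (Finset.mem_univ _)
            simpa [hrefl z] using this
          simp [this]
        · field_simp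

theorem aux_cs {Z : Type*} [Fintype Z] (μ : Z → ℝ) (hμ : ∀ z, 0 ≤ μ z) (f : Z → ℝ) :
    (∑ z, μ z * f z) ^ 2 ≤ (∑ z, μ z) * ∑ z, μ z * f z ^ 2 := by
  have := Finset.sum_mul_sq_le_sq_mul_sq Finset.univ (fun z => Real.sqrt (μ z)) (fun z => Real.sqrt (μ z) * f z)
  simp only [mul_pow, Real.sq_sqrt (hμ _), ← mul_assoc, Real.mul_self_sqrt (hμ _)] at this
  exact this

theorem aux_half (p : ℝ) (M : ℕ) (hM : 1 ≤ M) (hp : 1 / (M : ℝ) ≤ p) (hp1 : p ≤ 1) :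
    (1 - p) ^ M ≤ 1 / 2 := by
  have hM0 : (0 : ℝ) < M := by exact_mod_cast hM
  have h1 : 1 - p ≤ Real.exp (-p) := by have := Real.add_one_le_exp (-p); linarith
  calc (1 - p) ^ M ≤ Real.exp (-p) ^ M := pow_le_pow_left₀ (by linarith) h1 M
    _ = Real.exp (-(M * p)) := by rw [← Real.exp_nat_mul]; ring_nf
    _ ≤ Real.exp (-1) := by
        apply Real.exp_le_exp.2
        rw [div_le_iff₀ hM0] at hp; linarith
    _ ≤ 1 / 2 := by
        rw [Real.exp_neg, one_div]
        apply inv_anti₀ (by norm_num)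
        have := Real.add_one_le_exp (1 : ℝ); linarith

theorem aux_sum_pi {ι : Type*} [Fintype ι] [DecidableEq ι] {X : ι → Type*} [∀ i, Fintype (X i)]
    (f : ∀ i, X i → ℝ) : ∑ φ : ∀ i, X i, ∏ i, f i (φ i) = ∏ i, ∑ x, f i x := by
  rw [Finset.prod_univ_sum, Fintype.piFinset_univ]

theorem aux_sum_pmap {r : ℕ} (Ω : Fin r → Type) [∀ i, Fintype (Ω i)] {h : ℕ}
    (f : ∀ i, Fin h → Ω i → ℝ) :
    ∑ φ : PMap Ω h, ∏ i, ∏ a, f i a (φ i a) = ∏ i, ∏ a, ∑ x, f i a x := by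
  rw [aux_sum_pi (X := fun i => Fin h → Ω i) (fun i u => ∏ a, f i a (u a))]
  exact Finset.prod_congr rfl fun i _ => aux_sum_pi (fun a => f i a)

noncomputable def updP {r : ℕ} {Ω : Fin r → Type} {h : ℕ} (φ : PMap Ω h) (i : Fin r) (a : Fin h)
    (x : Ω i) : PMap Ω h := Function.update φ i (Function.update (φ i) a x)

theorem updP_same {r : ℕ} {Ω : Fin r → Type} {h : ℕ} (φ : PMap Ω h) (i : Fin r) (a : Fin h)
    (x : Ω i) : updP φ i a x i a = x := by simp [updP]

theorem updP_ne {r : ℕ} {Ω : Fin r → Type} {h : ℕ} (φ : PMap Ω h) (i : Fin r) (a : Fin h)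
    (x : Ω i) (j : Fin r) (b : Fin h) (hne : (j, b) ≠ (i, a)) : updP φ i a x j b = φ j b := by
  unfold updP
  by_cases hj : j = i
  · subst hj
    have : b ≠ a := fun h => hne (by rw [h])
    simp [this]
  · simp [hj]

theorem updP_updP {r : ℕ} {Ω : Fin r → Type} {h : ℕ} (φ : PMap Ω h) (i : Fin r) (a : Fin h)
    (x : Ω i) : updP (updP φ i a x) i a (φ i a) = φ := by
  funext j b
  by_cases hj : (j, b) = (i, a)
  · obtain ⟨rfl, rfl⟩ := Prod.mk.inj hj
    rw [updP_same]
  · rw [updP_ne _ _ _ _ _ _ hj, updP_ne _ _ _ _ _ _ hj]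

theorem weight_updP {r : ℕ} (Ω : Fin r → Type) [∀ i, Fintype (Ω i)]
    (w : ∀ i, Ω i → ℝ) {h : ℕ} (φ : PMap Ω h) (i : Fin r) (a : Fin h) (x : Ω i) :
    pmapWeight Ω w (updP φ i a x) * w i (φ i a) = pmapWeight Ω w φ * w i x := by
  have e : ∀ φ : PMap Ω h, pmapWeight Ω w φ = ∏ p : Fin r × Fin h, w p.1 (φ p.1 p.2) := by
    intro φ; rw [Fintype.prod_prod_type]; rfl
  rw [e, e, ← Finset.mul_prod_erase _ _ (Finset.mem_univ (i, a)),
    ← Finset.mul_prod_erase Finset.univ (fun p : Fin r × Fin h => w p.1 (φ p.1 p.2)) (Finset.mem_univ (i, a))]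
  have : ∏ p ∈ Finset.univ.erase (i, a), w p.1 (updP φ i a x p.1 p.2) =
      ∏ p ∈ Finset.univ.erase (i, a), w p.1 (φ p.1 p.2) := by
    refine Finset.prod_congr rfl fun p hp => ?_
    rw [updP_ne _ _ _ _ _ _ (Finset.ne_of_mem_erase hp)]
  rw [this, updP_same]
  ring

theorem resample {r : ℕ} (Ω : Fin r → Type) [∀ i, Fintype (Ω i)]
    (w : ∀ i, Ω i → ℝ) (htot : ∀ i, ∑ x : Ω i, w i x = 1) {h : ℕ} (i : Fin r) (a : Fin h)
    (f : PMap Ω h → ℝ) :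
    ∑ φ : PMap Ω h, pmapWeight Ω w φ * f φ =
      ∑ φ : PMap Ω h, pmapWeight Ω w φ * ∑ x, w i x * f (updP φ i a x) := by
  have e1 : ∑ φ : PMap Ω h, pmapWeight Ω w φ * f φ =
      ∑ z : PMap Ω h × Ω i, pmapWeight Ω w z.1 * w i z.2 * f z.1 := by
    rw [Fintype.sum_prod_type]
    refine Finset.sum_congr rfl fun φ _ => ?_
    simp only
    rw [← Finset.sum_mul, ← Finset.mul_sum, htot, mul_one]
  have e2 : ∑ φ : PMap Ω h, pmapWeight Ω w φ * ∑ x, w i x * f (updP φ i a x) =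
      ∑ z : PMap Ω h × Ω i, pmapWeight Ω w z.1 * w i z.2 * f (updP z.1 i a z.2) := by
    rw [Fintype.sum_prod_type]
    refine Finset.sum_congr rfl fun φ _ => ?_
    rw [Finset.mul_sum]
    exact Finset.sum_congr rfl fun x _ => by ring
  rw [e1, e2]
  let σ : PMap Ω h × Ω i → PMap Ω h × Ω i := fun z => (updP z.1 i a z.2, z.1 i a)
  have hσ : Function.Involutive σ := by
    rintro ⟨φ, x⟩
    simp only [σ, updP_updP, updP_same]
  rw [← Equiv.sum_comp hσ.toPerm (fun z : PMap Ω h × Ω i => pmapWeight Ω w z.1 * w i z.2 * f z.1)]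
  refine Finset.sum_congr rfl fun z _ => ?_
  simp only [Function.Involutive.coe_toPerm, σ]
  rw [weight_updP]

theorem resample2 {r : ℕ} (Ω : Fin r → Type) [∀ i, Fintype (Ω i)]
    (w : ∀ i, Ω i → ℝ) (htot : ∀ i, ∑ x : Ω i, w i x = 1) {h : ℕ} (i j : Fin r) (a b : Fin h)
    (f : PMap Ω h → ℝ) :
    ∑ φ : PMap Ω h, pmapWeight Ω w φ * f φ =
      ∑ φ : PMap Ω h, pmapWeight Ω w φ *
        ∑ z : Ω i × Ω j, w i z.1 * w j z.2 * f (updP (updP φ i a z.1) j b z.2) := by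
  rw [resample Ω w htot j b f, resample Ω w htot i a]
  refine Finset.sum_congr rfl fun φ _ => ?_
  rw [Fintype.sum_prod_type]
  congr 1
  refine Finset.sum_congr rfl fun x _ => ?_
  rw [Finset.mul_sum]
  exact Finset.sum_congr rfl fun x _ => by ring

theorem pmapWeight_nonneg {r : ℕ} (Ω : Fin r → Type) [∀ i, Fintype (Ω i)]
    (w : ∀ i, Ω i → ℝ) (hw : ∀ i x, 0 ≤ w i x) {h : ℕ} (φ : PMap Ω h) : 0 ≤ pmapWeight Ω w φ :=
  Finset.prod_nonneg fun _ _ => Finset.prod_nonneg fun _ _ => hw _ _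

theorem pmapWeight_sum {r : ℕ} (Ω : Fin r → Type) [∀ i, Fintype (Ω i)]
    (w : ∀ i, Ω i → ℝ) (htot : ∀ i, ∑ x : Ω i, w i x = 1) (h : ℕ) :
    ∑ φ : PMap Ω h, pmapWeight Ω w φ = 1 := by
  unfold pmapWeight
  rw [aux_sum_pmap Ω (fun i _ x => w i x)]
  simp [htot]

/-- splitting a sample of size `M * h` into `M` blocks -/
def blockEquiv {r : ℕ} (Ω : Fin r → Type) (M h : ℕ) : (Fin M → PMap Ω h) ≃ PMap Ω (M * h) where
  toFun Ψ := fun i c => Ψ (finProdFinEquiv.symm c).1 i (finProdFinEquiv.symm c).2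
  invFun ψ := fun m i a => ψ i (finProdFinEquiv (m, a))
  left_inv Ψ := by funext m i a; simp only [Equiv.symm_apply_apply]
  right_inv ψ := by funext i c; simp only [Prod.mk.eta, Equiv.apply_symm_apply]

theorem blockEquiv_apply {r : ℕ} (Ω : Fin r → Type) (M h : ℕ) (Ψ : Fin M → PMap Ω h)
    (i : Fin r) (m : Fin M) (a : Fin h) :
    blockEquiv Ω M h Ψ i (finProdFinEquiv (m, a)) = Ψ m i a := by
  simp only [blockEquiv, Equiv.coe_fn_mk, Equiv.symm_apply_apply]

theorem blockEquiv_weight {r : ℕ} (Ω : Fin r → Type) [∀ i, Fintype (Ω i)]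
    (w : ∀ i, Ω i → ℝ) (M h : ℕ) (Ψ : Fin M → PMap Ω h) :
    pmapWeight Ω w (blockEquiv Ω M h Ψ) = ∏ m, pmapWeight Ω w (Ψ m) := by
  unfold pmapWeight
  rw [Finset.prod_comm (s := (Finset.univ : Finset (Fin M)))]
  refine Finset.prod_congr rfl fun i _ => ?_
  rw [← finProdFinEquiv.prod_comp, Fintype.prod_prod_type]
  simp only [blockEquiv_apply]

theorem vprob {r h : ℕ} (Ω : Fin r → Type) [∀ i, Fintype (Ω i)]
    (w : ∀ i, Ω i → ℝ) (htot : ∀ i, ∑ x : Ω i, w i x = 1) {K₁ K₂ : Type} (G : CGraph Ω K₁ K₂)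
    (S : SComplex r h K₁ K₂) :
    (∑ φ : PMap Ω h, if vEvent G S φ then pmapWeight Ω w φ else 0) = ∏ p ∈ V1 S, dVS Ω w G S p := by
  let f : ∀ i, Fin h → Ω i → ℝ := fun i a x =>
    if S.vCol i a ≠ none → some (G.vCol i x) = S.vCol i a then w i x else 0
  have e1 : ∀ φ : PMap Ω h, (if vEvent G S φ then pmapWeight Ω w φ else 0) =
      ∏ i, ∏ a, f i a (φ i a) := by
    intro φ
    have : ∏ i, ∏ a, f i a (φ i a) = ∏ p : Fin r × Fin h, f p.1 p.2 (φ p.1 p.2) := by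
      rw [Fintype.prod_prod_type]
    rw [this]
    have e : pmapWeight Ω w φ = ∏ p : Fin r × Fin h, w p.1 (φ p.1 p.2) := by
      rw [Fintype.prod_prod_type]; rfl
    rw [e]
    by_cases hv : vEvent G S φ
    · rw [if_pos hv]
      refine Finset.prod_congr rfl fun p _ => ?_
      simp only [f]
      rw [if_pos (fun hp => hv p (by simpa [V1] using hp))]
    · rw [if_neg hv]
      have hv' := hv
      unfold vEvent at hv'
      push Not at hv'
      obtain ⟨p, hp, hne⟩ := hv'
      symm
      refine Finset.prod_eq_zero (Finset.mem_univ p) ?_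
      simp only [f]
      rw [if_neg]
      intro hcon
      exact hne (hcon (by simpa [V1] using hp))
  rw [Finset.sum_congr rfl fun φ _ => e1 φ, aux_sum_pmap Ω f]
  have : ∏ i, ∏ a, ∑ x, f i a x = ∏ p : Fin r × Fin h, ∑ x, f p.1 p.2 x := by
    rw [Fintype.prod_prod_type]
  rw [this, V1, Finset.prod_filter]
  refine Finset.prod_congr rfl fun p _ => ?_
  rcases hc : S.vCol p.1 p.2 with _ | c
  · simp [f, hc, htot]
  · simp [f, hc, dVS, dV]

theorem condEE_eq {r : ℕ} (Ω : Fin r → Type)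
    [∀ i, Fintype (Ω i)] (w : ∀ i, Ω i → ℝ) (i j : Fin r) (A : Ω i → Ω j → Prop)
    (inst : ∀ x y, Decidable (A x y)) (f : Ω i → Ω j → ℝ) :
    condEE Ω w i j A f =
      (∑ z : Ω i × Ω j, (@ite _ (A z.1 z.2) (inst z.1 z.2) (w i z.1 * w j z.2) 0) * f z.1 z.2) /
      (∑ z : Ω i × Ω j, @ite _ (A z.1 z.2) (inst z.1 z.2) (w i z.1 * w j z.2) 0) := by
  rw [Fintype.sum_prod_type, Fintype.sum_prod_type]
  unfold condEE
  simp only [ite_mul, zero_mul]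
  congr!

theorem core_step {r : ℕ} (Ω : Fin r → Type)
    [∀ i, Fintype (Ω i)] (w : ∀ i, Ω i → ℝ)
    (hw : ∀ i x, 0 ≤ w i x) 
    {K₁ K₂ : Type} [Fintype K₁] [Fintype K₂] (G : CGraph Ω K₁ K₂)
    {m : ℕ} (ψ : PMap Ω m) (i j : Fin r) (c₂ : K₂) (ci cj : K₁) (d : ℝ)
    (K : Ω i × Ω j → ℝ) (hK1 : ∀ z, |K z| ≤ 1)
    (hK : ∀ z z' : Ω i × Ω j, frameRel Ω G ψ i j z.1 z.2 z'.1 z'.2 → K z = K z')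
    (hdd : 0 < ∑ z : Ω i × Ω j, if G.vCol i z.1 = ci ∧ G.vCol j z.2 = cj then w i z.1 * w j z.2 else 0) :
    ((∑ z : Ω i × Ω j, (if G.vCol i z.1 = ci ∧ G.vCol j z.2 = cj then w i z.1 * w j z.2 else 0) *
        (((if G.eCol i j z.1 z.2 = c₂ then 1 else 0) - d) * K z)) /
     (∑ z : Ω i × Ω j, if G.vCol i z.1 = ci ∧ G.vCol j z.2 = cj then w i z.1 * w j z.2 else 0)) ^ 2 ≤
    condEE Ω w i j (fun x' y' => G.vCol i x' = ci ∧ G.vCol j y' = cj) fun x' y' =>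
      (condEE Ω w i j (fun x y => frameRel Ω G ψ i j x y x' y')
          (fun x y => if G.eCol i j x y = c₂ then 1 else 0) - d) ^ 2 := by
  set Q : Ω i × Ω j → ℝ := fun z => condEE Ω w i j (fun x y => frameRel Ω G ψ i j x y z.1 z.2)
          (fun x y => if G.eCol i j x y = c₂ then 1 else 0) with hQ
  set ν : Ω i × Ω j → ℝ := fun z =>
    if G.vCol i z.1 = ci ∧ G.vCol j z.2 = cj then w i z.1 * w j z.2 else 0 with hν
  have hν0 : ∀ z, 0 ≤ ν z := fun z => by
    simp only [hν]; split_ifs; exacts [mul_nonneg (hw _ _) (hw _ _), le_rfl]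
  have hR : condEE Ω w i j (fun x' y' => G.vCol i x' = ci ∧ G.vCol j y' = cj) (fun x' y' =>
      (condEE Ω w i j (fun x y => frameRel Ω G ψ i j x y x' y')
          (fun x y => if G.eCol i j x y = c₂ then 1 else 0) - d) ^ 2) =
      (∑ z, ν z * (Q z - d) ^ 2) / ∑ z, ν z := by
    exact condEE_eq Ω w i j _ _ _
  rw [hR]
  have hT := aux_tower (fun z : Ω i × Ω j => w i z.1 * w j z.2)
    (fun z => mul_nonneg (hw _ _) (hw _ _)) (fun z z' => frameRel Ω G ψ i j z.1 z.2 z'.1 z'.2)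
    (fun z => ⟨rfl, rfl⟩) (fun z z' h => ⟨h.1.symm, h.2.symm⟩)
    (fun a b c h h' => ⟨h.1.trans h'.1, h.2.trans h'.2⟩)
    (fun z => if G.eCol i j z.1 z.2 = c₂ then 1 else 0)
    (fun z => (if G.vCol i z.1 = ci ∧ G.vCol j z.2 = cj then 1 else 0) * K z)
    (fun z z' h => by
      have h1 : G.vCol i z.1 = G.vCol i z'.1 := congrArg Prod.fst h.1
      have h2 : G.vCol j z.2 = G.vCol j z'.2 := congrArg Prod.fst h.2
      simp only [h1, h2, hK z z' h])
  have hQ' : ∀ z : Ω i × Ω j, ((∑ z' : Ω i × Ω j, if frameRel Ω G ψ i j z'.1 z'.2 z.1 z.2 then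
      w i z'.1 * w j z'.2 * (if G.eCol i j z'.1 z'.2 = c₂ then 1 else 0) else 0) /
      (∑ z' : Ω i × Ω j, if frameRel Ω G ψ i j z'.1 z'.2 z.1 z.2 then
      w i z'.1 * w j z'.2 else 0)) = Q z := by
    intro z
    rw [Fintype.sum_prod_type, Fintype.sum_prod_type]
    rfl
  have hν' : ∀ z : Ω i × Ω j, w i z.1 * w j z.2 *
      ((if G.vCol i z.1 = ci ∧ G.vCol j z.2 = cj then 1 else 0) * K z) = ν z * K z := by
    intro z; simp only [hν]; split_ifs <;> ring
  simp only [hQ', hν'] at hT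
  have hN : ∑ z, ν z * (((if G.eCol i j z.1 z.2 = c₂ then 1 else 0) - d) * K z) =
      ∑ z, ν z * ((Q z - d) * K z) := by
    have a1 : ∀ F : Ω i × Ω j → ℝ, ∑ z, ν z * ((F z - d) * K z) =
        ∑ z, ν z * K z * F z - ∑ z, ν z * K z * d := by
      intro F
      rw [← Finset.sum_sub_distrib]
      exact Finset.sum_congr rfl fun z _ => by ring
    rw [a1, a1, hT]
  rw [hN, div_pow, div_le_div_iff₀ (by positivity) hdd]
  have hcs := aux_cs ν hν0 (fun z => (Q z - d) * K z)
  have hle : ∑ z, ν z * ((Q z - d) * K z) ^ 2 ≤ ∑ z, ν z * (Q z - d) ^ 2 := by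
    refine Finset.sum_le_sum fun z _ => mul_le_mul_of_nonneg_left ?_ (hν0 z)
    rw [mul_pow]
    have : K z ^ 2 ≤ 1 := (sq_le_one_iff_abs_le_one _).2 (hK1 z)
    exact mul_le_of_le_one_right (sq_nonneg _) this
  have h3 := mul_le_mul_of_nonneg_left hle hdd.le
  have h4 := mul_le_mul_of_nonneg_right (hcs.trans h3) hdd.le
  refine h4.trans (le_of_eq ?_)
  ring

theorem dES_mem {r h : ℕ} (Ω : Fin r → Type) [∀ i, Fintype (Ω i)]
    (w : ∀ i, Ω i → ℝ) (hw : ∀ i x, 0 ≤ w i x) {K₁ K₂ : Type} (G : CGraph Ω K₁ K₂)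
    (S : SComplex r h K₁ K₂) (q : Fin r × Fin r × Fin h × Fin h) :
    0 ≤ dES Ω w G S q ∧ dES Ω w G S q ≤ 1 := by
  unfold dES
  split
  · unfold dE
    refine ⟨div_nonneg ?_ ?_, div_le_one_of_le₀ ?_ ?_⟩
    · refine Finset.sum_nonneg fun x _ => Finset.sum_nonneg fun y _ => ?_
      split_ifs
      exacts [mul_nonneg (hw _ _) (hw _ _), le_rfl]
    · refine Finset.sum_nonneg fun x _ => Finset.sum_nonneg fun y _ => ?_
      split_ifs
      exacts [mul_nonneg (hw _ _) (hw _ _), le_rfl]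
    swap
    · refine Finset.sum_nonneg fun x _ => Finset.sum_nonneg fun y _ => ?_
      split_ifs
      exacts [mul_nonneg (hw _ _) (hw _ _), le_rfl]
    refine Finset.sum_le_sum fun x _ => Finset.sum_le_sum fun y _ => ?_
    have := mul_nonneg (hw q.1 x) (hw q.2.1 y)
    split_ifs with h1 h2 <;> first | exact le_rfl | exact this | (exact absurd h1.2 h2)
  · norm_num

theorem ind_abs {r h : ℕ} (Ω : Fin r → Type) [∀ i, Fintype (Ω i)]
    (w : ∀ i, Ω i → ℝ) (hw : ∀ i x, 0 ≤ w i x) {K₁ K₂ : Type} (G : CGraph Ω K₁ K₂)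
    (S : SComplex r h K₁ K₂) (φ : PMap Ω h) (q : Fin r × Fin r × Fin h × Fin h) :
    |indMinusD Ω w G S φ q| ≤ 1 := by
  obtain ⟨h0, h1⟩ := dES_mem Ω w hw G S q
  unfold indMinusD
  rw [abs_le]
  split_ifs <;> constructor <;> linarith

theorem ind_frame {r h : ℕ} (Ω : Fin r → Type) [∀ i, Fintype (Ω i)]
    (w : ∀ i, Ω i → ℝ) {K₁ K₂ : Type} [Fintype K₁] [Fintype K₂] (G : CGraph Ω K₁ K₂)
    (S : SComplex r h K₁ K₂) (φ : PMap Ω h) {m : ℕ} (ψ : PMap Ω m)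
    (hφψ : ∀ i a, ∃ c, ψ i c = φ i a)
    (i j : Fin r) (hij : i < j) (a b : Fin h) (x x' : Ω i) (y y' : Ω j)
    (hfr : frameRel Ω G ψ i j x y x' y')
    (q : Fin r × Fin r × Fin h × Fin h) (hq : q.1 < q.2.1) (hne : q ≠ (i, j, a, b)) :
    indMinusD Ω w G S (updP (updP φ i a x) j b y) q =
      indMinusD Ω w G S (updP (updP φ i a x') j b y') q := by
  obtain ⟨k, l, s, t⟩ := q
  simp only at hq
  have hx : ∀ l, l ≠ i → ∀ t, G.eCol i l x (φ l t) = G.eCol i l x' (φ l t) := by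
    intro l hl t
    obtain ⟨c, hc⟩ := hφψ l t
    have := congrFun (congrFun (congrArg Prod.snd hfr.1) l) c
    simp only [regz, hl, if_false, hc] at this
    exact Option.some.inj this
  have hy : ∀ l, l ≠ j → ∀ t, G.eCol j l y (φ l t) = G.eCol j l y' (φ l t) := by
    intro l hl t
    obtain ⟨c, hc⟩ := hφψ l t
    have := congrFun (congrFun (congrArg Prod.snd hfr.2) l) c
    simp only [regz, hl, if_false, hc] at this
    exact Option.some.inj this
  have key : G.eCol k l (updP (updP φ i a x) j b y k s) (updP (updP φ i a x) j b y l t) =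
      G.eCol k l (updP (updP φ i a x') j b y' k s) (updP (updP φ i a x') j b y' l t) := by
    have uj : ∀ (x : Ω i) (y : Ω j), updP (updP φ i a x) j b y j b = y := fun x y => updP_same _ _ _ _
    have ui : ∀ (x : Ω i) (y : Ω j), updP (updP φ i a x) j b y i a = x := fun x y => by
      rw [updP_ne _ _ _ _ _ _ (fun h => hij.ne (Prod.mk.inj h).1), updP_same]
    have uo : ∀ (x : Ω i) (y : Ω j) k s, (k, s) ≠ (i, a) → (k, s) ≠ (j, b) →
        updP (updP φ i a x) j b y k s = φ k s := fun x y k s h1 h2 => by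
      rw [updP_ne _ _ _ _ _ _ h2, updP_ne _ _ _ _ _ _ h1]
    by_cases h1 : (k, s) = (i, a)
    · obtain ⟨rfl, rfl⟩ := Prod.mk.inj h1
      have h2 : (l, t) ≠ (j, b) := by rintro h2; obtain ⟨rfl, rfl⟩ := Prod.mk.inj h2; exact hne rfl
      have h3 : (l, t) ≠ (k, s) := fun h3 => hq.ne' (Prod.mk.inj h3).1
      rw [ui, ui, uo _ _ _ _ h3 h2, uo _ _ _ _ h3 h2]
      exact hx l hq.ne' t
    · by_cases h2 : (k, s) = (j, b)
      · obtain ⟨rfl, rfl⟩ := Prod.mk.inj h2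
        have h3 : (l, t) ≠ (k, s) := fun h3 => hq.ne' (Prod.mk.inj h3).1
        have h4 : (l, t) ≠ (i, a) := fun h4 => (hij.trans hq).ne' (Prod.mk.inj h4).1
        rw [uj, uj, uo _ _ _ _ h4 h3, uo _ _ _ _ h4 h3]
        exact hy l hq.ne' t
      · rw [uo _ _ _ _ h1 h2, uo _ _ _ _ h1 h2]
        by_cases h3 : (l, t) = (i, a)
        · obtain ⟨rfl, rfl⟩ := Prod.mk.inj h3
          rw [ui, ui, G.eSymm, G.eSymm k]
          exact hx k hq.ne s
        · by_cases h4 : (l, t) = (j, b)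
          · obtain ⟨rfl, rfl⟩ := Prod.mk.inj h4
            rw [uj, uj, G.eSymm, G.eSymm k]
            exact hy k hq.ne s
          · rw [uo _ _ _ _ h3 h4, uo _ _ _ _ h3 h4]
  unfold indMinusD
  simp only
  rw [key]

theorem corr_core {r : ℕ} (Ω : Fin r → Type)
    [∀ i, Fintype (Ω i)] (w : ∀ i, Ω i → ℝ)
    (hw : ∀ i x, 0 ≤ w i x) (htot : ∀ i, ∑ x : Ω i, w i x = 1)
    {K₁ K₂ : Type} [Fintype K₁] [Fintype K₂] (G : CGraph Ω K₁ K₂)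
    (h M : ℕ) (hM : 1 ≤ M)
    (S : SComplex r h K₁ K₂)
    (hM' : (1 : ℝ) / M ≤ ∏ p ∈ V1 S, dVS Ω w G S p)
    (D : Finset (Fin r × Fin r × Fin h × Fin h)) (hD : D ⊆ V2 S)
    (i j : Fin r) (a b : Fin h) (hq : (i, j, a, b) ∈ D) :
    (EPhiCond Ω w h (vEvent G S) (fun φ => ∏ q ∈ D, indMinusD Ω w G S φ q)) ^ 2 ≤
      2 * etaS Ω w G (M * h) S (i, j, a, b) := by
  have hV2 := hD hq
  simp only [V2, mem_filter, mem_univ, true_and] at hV2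
  obtain ⟨hij, hvis⟩ := hV2
  obtain ⟨c₂, hc₂⟩ := Option.ne_none_iff_exists'.1 hvis
  obtain ⟨ci, hci⟩ := Option.ne_none_iff_exists'.1 (fun hn => hvis (S.down i j a b hn))
  obtain ⟨cj, hcj⟩ := Option.ne_none_iff_exists'.1
    (fun hn => hvis ((S.eSymm i j a b).trans (S.down j i b a hn)))
  have hη : etaS Ω w G (M * h) S (i, j, a, b) = eta Ω w G (M * h) i j c₂ ci cj := by
    simp [etaS, hc₂, hci, hcj]
  have hd : dES Ω w G S (i, j, a, b) = dE Ω w G i j c₂ ci cj := by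
    simp [dES, hc₂, hci, hcj]
  rw [hη]
  set d := dE Ω w G i j c₂ ci cj with hddef
  set u : PMap Ω h → Ω i × Ω j → PMap Ω h := fun φ z => updP (updP φ i a z.1) j b z.2 with hu
  have uj : ∀ φ z, u φ z j b = z.2 := fun φ z => updP_same _ _ _ _
  have ui : ∀ φ z, u φ z i a = z.1 := fun φ z => by
    simp only [hu]
    rw [updP_ne _ _ _ _ _ _ (fun h => hij.ne (Prod.mk.inj h).1), updP_same]
  have uo : ∀ φ z k s, (k, s) ≠ (i, a) → (k, s) ≠ (j, b) → u φ z k s = φ k s :=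
    fun φ z k s h1 h2 => by
      simp only [hu]
      rw [updP_ne _ _ _ _ _ _ h2, updP_ne _ _ _ _ _ _ h1]
  obtain ⟨V', hV'⟩ : ∃ V' : PMap Ω h → Prop, ∀ φ, V' φ ↔ ∀ p ∈ V1 S, p ≠ (i, a) → p ≠ (j, b) →
    some (G.vCol p.1 (φ p.1 p.2)) = S.vCol p.1 p.2 := ⟨_, fun _ => Iff.rfl⟩
  set ν : Ω i × Ω j → ℝ := fun z =>
    if G.vCol i z.1 = ci ∧ G.vCol j z.2 = cj then w i z.1 * w j z.2 else 0 with hν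
  have hν0 : ∀ z, 0 ≤ ν z := fun z => by
    simp only [hν]; split_ifs; exacts [mul_nonneg (hw _ _) (hw _ _), le_rfl]
  have hνle : ∑ z, ν z ≤ 1 := by
    calc ∑ z, ν z ≤ ∑ z : Ω i × Ω j, w i z.1 * w j z.2 := by
          refine Finset.sum_le_sum fun z _ => ?_
          simp only [hν]; split_ifs; exacts [le_rfl, mul_nonneg (hw _ _) (hw _ _)]
      _ = 1 := by
          rw [Fintype.sum_prod_type]
          simp only [← Finset.mul_sum, htot, mul_one]
  have hvE : ∀ φ z, vEvent G S (u φ z) ↔ V' φ ∧ (G.vCol i z.1 = ci ∧ G.vCol j z.2 = cj) := by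
    intro φ z
    rw [hV']
    constructor
    · intro hv
      refine ⟨fun p hp h1 h2 => ?_, ?_, ?_⟩
      · rw [← uo φ z p.1 p.2 h1 h2]; exact hv p hp
      · have := hv (i, a) (by simp [V1, hci])
        simp only [ui, hci] at this
        exact Option.some.inj this
      · have := hv (j, b) (by simp [V1, hcj])
        simp only [uj, hcj] at this
        exact Option.some.inj this
    · rintro ⟨hv, h1, h2⟩ p hp
      by_cases hp1 : p = (i, a)
      · subst hp1; simp only [ui, hci, h1]
      · by_cases hp2 : p = (j, b)
        · subst hp2; simp only [uj, hcj, h2]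
        · rw [uo φ z p.1 p.2 hp1 hp2]; exact hv p hp hp1 hp2
  set W : PMap Ω h → ℝ := fun φ => pmapWeight Ω w φ with hWdef
  have hW0 : ∀ φ, 0 ≤ W φ := fun φ => pmapWeight_nonneg Ω w hw φ
  have hW1 : ∑ φ, W φ = 1 := pmapWeight_sum Ω w htot h
  have hnum : ∀ f : PMap Ω h → ℝ, (∑ φ, if vEvent G S φ then W φ * f φ else 0) =
      ∑ φ, if V' φ then W φ * ∑ z, ν z * f (u φ z) else 0 := by
    intro f
    have := resample2 Ω w htot i j a b (fun φ => if vEvent G S φ then f φ else 0)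
    calc _ = ∑ φ, W φ * (if vEvent G S φ then f φ else 0) := by
          refine Finset.sum_congr rfl fun φ _ => ?_
          split_ifs <;> simp
      _ = _ := this
      _ = _ := by
          refine Finset.sum_congr rfl fun φ _ => ?_
          have e : ∀ z : Ω i × Ω j, w i z.1 * w j z.2 *
              (if vEvent G S (updP (updP φ i a z.1) j b z.2) then f (updP (updP φ i a z.1) j b z.2) else 0) =
              if V' φ then ν z * f (u φ z) else 0 := by
            intro z
            have := hvE φ z
            simp only [hu] at this
            rw [if_congr this rfl rfl]
            simp only [hν, hu]
            by_cases h1 : V' φ <;> by_cases h2 : (G.vCol i z.1 = ci ∧ G.vCol j z.2 = cj) <;>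
              simp [h1, h2]
          rw [Finset.sum_congr rfl fun z _ => e z]
          by_cases h1 : V' φ
          · simp only [h1, if_true]; rfl
          · simp [h1]
  set dd := ∑ z, ν z with hdd
  set p' := ∑ φ, (if V' φ then W φ else 0) with hp'
  have hden : (∑ φ, if vEvent G S φ then W φ else 0) = p' * dd := by
    have := hnum (fun _ => 1)
    simp only [mul_one] at this
    rw [this, hp', Finset.sum_mul]
    exact Finset.sum_congr rfl fun φ _ => by split_ifs <;> simp [hdd]
  have hpp : (∑ φ, if vEvent G S φ then W φ else 0) = ∏ p ∈ V1 S, dVS Ω w G S p :=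
    vprob Ω w htot G S
  have hM0 : (0 : ℝ) < M := by exact_mod_cast hM
  have hpM : 1 / (M : ℝ) ≤ p' * dd := by rw [← hden, hpp]; exact hM'
  have hprod : 0 < p' * dd := lt_of_lt_of_le (by positivity) hpM
  have hdd0 : 0 ≤ dd := Finset.sum_nonneg fun z _ => hν0 z
  have hp'0 : 0 ≤ p' := Finset.sum_nonneg fun φ _ => by split_ifs; exacts [hW0 φ, le_rfl]
  have hddpos : 0 < dd := lt_of_le_of_ne hdd0 (fun h => by rw [← h, mul_zero] at hprod; exact lt_irrefl _ hprod)
  have hp'pos : 0 < p' := lt_of_le_of_ne hp'0 (fun h => by rw [← h, zero_mul] at hprod; exact lt_irrefl _ hprod)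
  have hp'M : 1 / (M : ℝ) ≤ p' := hpM.trans (mul_le_of_le_one_right hp'0 hνle)
  have hp'1 : p' ≤ 1 := by
    rw [← hW1]
    exact Finset.sum_le_sum fun φ _ => by split_ifs; exacts [le_rfl, hW0 φ]
  have hhalf := aux_half p' M hM hp'M hp'1
  set P : PMap Ω h → ℝ := fun φ => ∏ q ∈ D, indMinusD Ω w G S φ q with hP
  let F : PMap Ω h → ℝ := fun φ => (∑ z, ν z * P (u φ z)) / dd
  let T : PMap Ω (M * h) → ℝ := fun ψ =>
    condEE Ω w i j (fun x' y' => G.vCol i x' = ci ∧ G.vCol j y' = cj) fun x' y' =>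
      (condEE Ω w i j (fun x y => frameRel Ω G ψ i j x y x' y')
          (fun x y => if G.eCol i j x y = c₂ then 1 else 0) - d) ^ 2
  have hFT : ∀ (φ : PMap Ω h) (ψ : PMap Ω (M * h)), (∀ i a, ∃ c, ψ i c = φ i a) → F φ ^ 2 ≤ T ψ := by
    intro φ ψ hφψ
    have hP' : ∀ z, P (u φ z) = ((if G.eCol i j z.1 z.2 = c₂ then 1 else 0) - d) *
        ∏ q ∈ D.erase (i, j, a, b), indMinusD Ω w G S (u φ z) q := by
      intro z
      simp only [hP]
      rw [← Finset.mul_prod_erase _ _ hq]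
      congr 1
      simp only [indMinusD, hd, ui, uj, hc₂, Option.some.injEq]
    have := core_step Ω w hw G ψ i j c₂ ci cj d
      (fun z => ∏ q ∈ D.erase (i, j, a, b), indMinusD Ω w G S (u φ z) q)
      (fun z => by
        rw [Finset.abs_prod]
        exact Finset.prod_le_one (fun _ _ => abs_nonneg _) (fun q _ => ind_abs Ω w hw G S _ q))
      (fun z z' hz => by
        refine Finset.prod_congr rfl fun q hq' => ?_
        have h2 := hD (Finset.mem_of_mem_erase hq')
        simp only [V2, mem_filter, mem_univ, true_and] at h2
        exact ind_frame Ω w G S φ ψ hφψ i j hij a b z.1 z'.1 z.2 z'.2 hz q h2.1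
          (Finset.ne_of_mem_erase hq'))
      hddpos
    simp only [F, hP']
    exact this
  have hT0 : ∀ ψ, 0 ≤ T ψ := fun ψ => by
    refine div_nonneg ?_ ?_
    · refine Finset.sum_nonneg fun x _ => Finset.sum_nonneg fun y _ => ?_
      split_ifs
      exacts [mul_nonneg (mul_nonneg (hw _ _) (hw _ _)) (sq_nonneg _), le_rfl]
    · refine Finset.sum_nonneg fun x _ => Finset.sum_nonneg fun y _ => ?_
      split_ifs
      exacts [mul_nonneg (hw _ _) (hw _ _), le_rfl]
  have hfirst := aux_first W hW0 hW1 V' (fun φ => F φ ^ 2) M (fun Ψ => T (blockEquiv Ω M h Ψ))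
    (fun Ψ => hT0 _)
    (fun Ψ m _ => hFT _ _ (fun i a => ⟨finProdFinEquiv (m, a), blockEquiv_apply Ω M h Ψ i m a⟩))
  have hE : ∑ Ψ : Fin M → PMap Ω h, (∏ m, W (Ψ m)) * T (blockEquiv Ω M h Ψ) =
      eta Ω w G (M * h) i j c₂ ci cj := by
    have : eta Ω w G (M * h) i j c₂ ci cj = ∑ ψ : PMap Ω (M * h), pmapWeight Ω w ψ * T ψ := rfl
    rw [this, ← Equiv.sum_comp (blockEquiv Ω M h)]
    refine Finset.sum_congr rfl fun Ψ _ => ?_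
    rw [blockEquiv_weight]
  rw [hE] at hfirst
  set η := eta Ω w G (M * h) i j c₂ ci cj with hηdef
  set B := ∑ φ, (if V' φ then W φ * F φ ^ 2 else 0) with hB
  have hB0 : 0 ≤ B := Finset.sum_nonneg fun φ _ => by
    split_ifs; exacts [mul_nonneg (hW0 φ) (sq_nonneg _), le_rfl]
  have hfirst' : (1 - (1 - p') ^ M) * B ≤ p' * η := by
    exact hfirst
  have hBη : B ≤ 2 * (p' * η) := by
    have : (1 / 2) * B ≤ (1 - (1 - p') ^ M) * B :=
      mul_le_mul_of_nonneg_right (by linarith) hB0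
    linarith
  have hLHS : EPhiCond Ω w h (vEvent G S) P = (∑ φ, if V' φ then W φ * F φ else 0) / p' := by
    have : EPhiCond Ω w h (vEvent G S) P = (∑ φ, if vEvent G S φ then W φ * P φ else 0) /
      (∑ φ, if vEvent G S φ then W φ else 0) := rfl
    rw [this, hnum, hden]
    have e : (∑ φ, if V' φ then W φ * ∑ z, ν z * P (u φ z) else 0) =
        (∑ φ, if V' φ then W φ * F φ else 0) * dd := by
      rw [Finset.sum_mul]
      refine Finset.sum_congr rfl fun φ _ => ?_
      simp only [F]
      split_ifs
      · field_simp
      · simp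
    rw [e, mul_div_mul_right _ _ hddpos.ne']
  rw [hLHS]
  have hcs := aux_cs (fun φ => if V' φ then W φ else 0)
    (fun φ => by split_ifs; exacts [hW0 φ, le_rfl]) F
  simp only [ite_mul, zero_mul] at hcs
  rw [div_pow, div_le_iff₀ (by positivity)]
  calc _ ≤ p' * B := hcs
    _ ≤ p' * (2 * (p' * η)) := mul_le_mul_of_nonneg_left hBη hp'0
    _ = _ := by ring

/-- eq. (\ref{lj23j}). For `S ∈ S_{h,G*}` with positive visible
vertex densities and `1/M ≤ ∏_{v∈𝕍₁(S)} d_{G*}(S⟨v⟩)`, and any nonempty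
`D ⊆ 𝕍₂(S)`:
`(E[∏_{e∈D}(𝟙[G*(φ(e))=S(e)] − d_{G*}(S⟨e⟩)) | G*(φ(v))=S(v) ∀v∈𝕍₁(S)])² ≤
 2 · min_{e₀∈D} η(S⟨e₀⟩)`, where `η` is computed with sample size `M·h`. -/
theorem correlation_le_min_eta {r : ℕ} (Ω : Fin r → Type)
    [∀ i, Fintype (Ω i)] [∀ i, Nonempty (Ω i)] (w : ∀ i, Ω i → ℝ)
    (hw : ∀ i x, 0 ≤ w i x) (htot : ∀ i, ∑ x : Ω i, w i x = 1)
    {K₁ K₂ : Type} [Fintype K₁] [Fintype K₂] (G : CGraph Ω K₁ K₂)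
    (h M : ℕ) (hh : 1 ≤ h) (hM : 1 ≤ M)
    (S : SComplex r h K₁ K₂) (hS : S.MemS G)
    (hpos : ∀ p ∈ V1 S, 0 < dVS Ω w G S p)
    (hM' : (1 : ℝ) / M ≤ ∏ p ∈ V1 S, dVS Ω w G S p)
    (D : Finset (Fin r × Fin r × Fin h × Fin h)) (hD : D ⊆ V2 S) (hDne : D.Nonempty) :
    (EPhiCond Ω w h (vEvent G S) (fun φ => ∏ q ∈ D, indMinusD Ω w G S φ q)) ^ 2 ≤
      2 * D.inf' hDne (fun q => etaS Ω w G (M * h) S q) := by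
  obtain ⟨q, hq, he⟩ := Finset.exists_mem_eq_inf' hDne (fun q => etaS Ω w G (M * h) S q)
  rw [he]
  obtain ⟨i, j, a, b⟩ := q
  exact corr_core Ω w hw htot G h M hM S hM' D hD i j a b hq
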